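/- Let P and V be symmetric positive definite n×n real matrices, let τ > 0 be such that τ V⁻¹ − P⁻¹ is positive definite (equivalently, P − τ⁻¹V is positive definite), let c ∈ ℝ^n, and let λ ∈ ℝ. Then the infimum over v ∈ ℝ^n of the function v ↦ λ − vᵀ P⁻¹ v − τ·(1 − (v − c)ᵀ V⁻¹ (v − c)) equals λ − τ − cᵀ (P − τ⁻¹ V)⁻¹ c, and it is attained at v* = τ (τ V⁻¹ − P⁻¹)⁻¹ V⁻¹ c. -/

import Mathlib

open Matrix

theorem aux_symm {n : ℕ} {B : Matrix (Fin n) (Fin n) ℝ} (hB : B.PosDef) (x y : Fin n → ℝ) :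
    x ⬝ᵥ (B *ᵥ y) = y ⬝ᵥ (B *ᵥ x) := by
  have h : Bᵀ = B := by simpa [Matrix.IsHermitian] using hB.isHermitian
  rw [dotProduct_mulVec, ← mulVec_transpose, h, dotProduct_comm]

/-- Closed-form minimization of the S-procedure certificate (equations (93)–(97) of
the paper): the infimum over `v` of
`λ − vᵀ P⁻¹ v − τ (1 − (v − c)ᵀ V⁻¹ (v − c))`
equals `λ − τ − cᵀ (P − τ⁻¹ V)⁻¹ c` and is attained at
`v* = τ (τ V⁻¹ − P⁻¹)⁻¹ V⁻¹ c`. -/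
theorem sProcedure_certificate_minimum
    (n : ℕ) (P V : Matrix (Fin n) (Fin n) ℝ) (hP : P.PosDef) (hV : V.PosDef)
    (τ : ℝ) (hτ : 0 < τ) (hPD : (τ • V⁻¹ - P⁻¹).PosDef)
    (c : Fin n → ℝ) (lam : ℝ) :
    IsLeast (Set.range fun v : Fin n → ℝ =>
        lam - v ⬝ᵥ (P⁻¹ *ᵥ v) - τ * (1 - (v - c) ⬝ᵥ (V⁻¹ *ᵥ (v - c))))
      (lam - τ - c ⬝ᵥ ((P - τ⁻¹ • V)⁻¹ *ᵥ c)) ∧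
    (lam - (τ • (((τ • V⁻¹ - P⁻¹)⁻¹ * V⁻¹) *ᵥ c)) ⬝ᵥ
        (P⁻¹ *ᵥ (τ • (((τ • V⁻¹ - P⁻¹)⁻¹ * V⁻¹) *ᵥ c))) -
      τ * (1 - ((τ • (((τ • V⁻¹ - P⁻¹)⁻¹ * V⁻¹) *ᵥ c)) - c) ⬝ᵥ
        (V⁻¹ *ᵥ ((τ • (((τ • V⁻¹ - P⁻¹)⁻¹ * V⁻¹) *ᵥ c)) - c)))) =
      lam - τ - c ⬝ᵥ ((P - τ⁻¹ • V)⁻¹ *ᵥ c) := by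
  have uP := (Matrix.isUnit_iff_isUnit_det _).1 hP.isUnit
  have uV := (Matrix.isUnit_iff_isUnit_det _).1 hV.isUnit
  have uM := (Matrix.isUnit_iff_isUnit_det _).1 hPD.isUnit
  have hN : (P - τ⁻¹ • V)⁻¹ = P⁻¹ * (τ • ((τ • V⁻¹ - P⁻¹)⁻¹ * V⁻¹)) := by
    apply Matrix.inv_eq_right_inv
    have h1 : (P - τ⁻¹ • V) * P⁻¹ = τ⁻¹ • (V * (τ • V⁻¹ - P⁻¹)) := by
      rw [sub_mul, mul_sub, Matrix.mul_nonsing_inv _ uP, mul_smul_comm,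
        Matrix.mul_nonsing_inv _ uV, smul_sub, smul_smul, inv_mul_cancel₀ hτ.ne', one_smul,
        smul_mul_assoc]
    rw [← mul_assoc, h1, smul_mul_smul_comm, inv_mul_cancel₀ hτ.ne', one_smul, mul_assoc,
      ← mul_assoc _ _ V⁻¹, Matrix.mul_nonsing_inv _ uM, one_mul, Matrix.mul_nonsing_inv _ uV]
  have hMw : (τ • V⁻¹ - P⁻¹) *ᵥ (τ • (((τ • V⁻¹ - P⁻¹)⁻¹ * V⁻¹) *ᵥ c)) = τ • (V⁻¹ *ᵥ c) := by
    rw [mulVec_smul, mulVec_mulVec, ← mul_assoc, Matrix.mul_nonsing_inv _ uM, one_mul]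
  have hd : (P - τ⁻¹ • V)⁻¹ *ᵥ c = P⁻¹ *ᵥ (τ • (((τ • V⁻¹ - P⁻¹)⁻¹ * V⁻¹) *ᵥ c)) := by
    rw [hN, ← mulVec_mulVec, smul_mulVec]
  rw [hd]
  generalize (τ • (((τ • V⁻¹ - P⁻¹)⁻¹ * V⁻¹) *ᵥ c)) = w at *
  have key : ∀ v : Fin n → ℝ,
      lam - v ⬝ᵥ (P⁻¹ *ᵥ v) - τ * (1 - (v - c) ⬝ᵥ (V⁻¹ *ᵥ (v - c))) =
      lam - τ - c ⬝ᵥ (P⁻¹ *ᵥ w) + (v - w) ⬝ᵥ ((τ • V⁻¹ - P⁻¹) *ᵥ (v - w)) := by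
    intro v
    have e : ∀ x : Fin n → ℝ, τ * (x ⬝ᵥ (V⁻¹ *ᵥ w)) - x ⬝ᵥ (P⁻¹ *ᵥ w)
        = τ * (x ⬝ᵥ (V⁻¹ *ᵥ c)) := by
      intro x
      have := congrArg (fun y => x ⬝ᵥ y) hMw
      simpa [sub_mulVec, smul_mulVec] using this
    have e1 := e v
    have e2 := e w
    have e3 := e c
    have s1 := aux_symm hP.inv w v
    have s2 := aux_symm hV.inv w v
    have s3 := aux_symm hV.inv c v
    have s4 := aux_symm hV.inv c w
    simp only [sub_mulVec, smul_mulVec, mulVec_sub, dotProduct_sub, sub_dotProduct,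
      dotProduct_smul, smul_eq_mul]
    rw [s1, s2, s3]
    rw [s4] at e3
    linarith
  have hw := key w
  rw [sub_self w, zero_dotProduct, add_zero] at hw
  refine ⟨⟨⟨w, hw⟩, ?_⟩, hw⟩
  rintro _ ⟨v, rfl⟩
  have := hPD.posSemidef.dotProduct_mulVec_nonneg (v - w)
  simp only [star_trivial] at this
  have k := key v
  simp only []
  linarith
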